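/- The infimum (in the extended reals) of the LP cost J_LP over all tuples feasible for the LP problem is less than or equal to the infimum of the original cost J_orig over all tuples feasible for the ORIGINAL problem. -/

import Mathlib

noncomputable section

/-- Saturation of `z` to the interval `[l, u]`. -/
def clamp (z l u : ℝ) : ℝ := max l (min z u)

/-- Feasibility for the ORIGINAL sizing problem. -/
def OrigFeas (K : ℕ) (Y X : ℕ → ℝ) (αbar αlow γ R amax Chat : ℝ)
    (a Cbar : ℝ) (C : ℕ → ℝ) : Prop :=
  0 ≤ Cbar ∧ 0 ≤ a ∧ a ≤ amax ∧ C 0 = Chat ∧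
  ∀ k ∈ Finset.Icc 1 K,
    C k = clamp (γ * C (k - 1) + a * Y (k - 1) - X (k - 1))
        (αlow * Cbar) (αbar * Cbar) ∧
    |C k - C (k - 1)| ≤ R * Cbar

/-- Cost of the ORIGINAL sizing problem. -/
def Jorig (K : ℕ) (Y X : ℕ → ℝ) (PiPV PiB PiR PiG αbar αlow γ : ℝ)
    (a Cbar : ℝ) (C : ℕ → ℝ) : ℝ :=
  PiPV * a + PiB * Cbar +
    ∑ k ∈ Finset.Icc 1 K,
      (PiR * max (γ * C (k - 1) + a * Y (k - 1) - X (k - 1) - αbar * Cbar) 0 +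
       PiG * max (αlow * Cbar - (γ * C (k - 1) + a * Y (k - 1) - X (k - 1))) 0)

/-- Feasibility for the LP relaxation. -/
def LPFeas (K : ℕ) (Y X : ℕ → ℝ) (αbar αlow γ R amax Chat : ℝ)
    (a Cbar : ℝ) (C φp φm : ℕ → ℝ) : Prop :=
  0 ≤ Cbar ∧ 0 ≤ a ∧ a ≤ amax ∧ C 0 = Chat ∧
  ∀ k ∈ Finset.Icc 1 K,
    C k + φp k - φm k = γ * C (k - 1) + a * Y (k - 1) - X (k - 1) ∧
    αlow * Cbar ≤ C k ∧ C k ≤ αbar * Cbar ∧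
    0 ≤ φp k ∧ 0 ≤ φm k ∧
    |C k - C (k - 1)| ≤ R * Cbar

/-- Cost of the LP relaxation. -/
def JLP (K : ℕ) (PiPV PiB PiR PiG : ℝ) (a Cbar : ℝ) (φp φm : ℕ → ℝ) : ℝ :=
  PiPV * a + PiB * Cbar + ∑ k ∈ Finset.Icc 1 K, (PiR * φp k + PiG * φm k)


/-- The excess over `u` and the shortfall below `l` account for the saturation error. -/
lemma clamp_add_excess_sub_shortfall {z l u : ℝ} (h : l ≤ u) :
    clamp z l u + max (z - u) 0 - max (l - z) 0 = z := by
  unfold clamp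
  grind

lemma le_clamp (z l u : ℝ) : l ≤ clamp z l u := le_max_left _ _

lemma clamp_le {z l u : ℝ} (h : l ≤ u) : clamp z l u ≤ u := max_le h (min_le_right _ _)

/-- A feasible tuple of the original problem, completed with its excesses and shortfalls,
is feasible for the linear program. -/
lemma OrigFeas.lpFeas {K : ℕ} {Y X : ℕ → ℝ} {αbar αlow γ R amax Chat a Cbar : ℝ} {C : ℕ → ℝ}
    (hα : αlow ≤ αbar) (h : OrigFeas K Y X αbar αlow γ R amax Chat a Cbar C) :
    LPFeas K Y X αbar αlow γ R amax Chat a Cbar C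
      (fun k => max (γ * C (k - 1) + a * Y (k - 1) - X (k - 1) - αbar * Cbar) 0)
      (fun k => max (αlow * Cbar - (γ * C (k - 1) + a * Y (k - 1) - X (k - 1))) 0) := by
  obtain ⟨hC, ha, ha', h0, hk⟩ := h
  have hlu : αlow * Cbar ≤ αbar * Cbar := mul_le_mul_of_nonneg_right hα hC
  refine ⟨hC, ha, ha', h0, fun k hkm => ?_⟩
  obtain ⟨hclamp, hramp⟩ := hk k hkm
  refine ⟨?_, ?_, ?_, le_max_right _ _, le_max_right _ _, hramp⟩
  · rw [hclamp]
    exact clamp_add_excess_sub_shortfall hlu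
  · rw [hclamp]
    exact le_clamp _ _ _
  · rw [hclamp]
    exact clamp_le hlu

/-- The infimum (in the extended reals) of the LP cost over LP-feasible tuples
is at most the infimum of the original cost over original-feasible tuples. -/
theorem LP_inf_le_orig_inf
    (K : ℕ) (hK : 1 ≤ K) (Y X : ℕ → ℝ) (PiPV PiB PiR PiG : ℝ)
    (αbar αlow γ R amax Chat : ℝ)
    (hαbar : 1 / 2 < αbar ∧ αbar ≤ 1) (hαlow : 0 ≤ αlow ∧ αlow < 1 / 2)
    (hγ : 0 < γ ∧ γ ≤ 1) (hR : 0 < R ∧ R ≤ 1) (hamax : 0 ≤ amax) :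
    sInf {c : EReal | ∃ (a Cbar : ℝ) (C φp φm : ℕ → ℝ),
        LPFeas K Y X αbar αlow γ R amax Chat a Cbar C φp φm ∧
        c = ((JLP K PiPV PiB PiR PiG a Cbar φp φm : ℝ) : EReal)} ≤
    sInf {c : EReal | ∃ (a Cbar : ℝ) (C : ℕ → ℝ),
        OrigFeas K Y X αbar αlow γ R amax Chat a Cbar C ∧
        c = ((Jorig K Y X PiPV PiB PiR PiG αbar αlow γ a Cbar C : ℝ) : EReal)} := by
  apply sInf_le_sInf
  rintro c ⟨a, Cbar, C, h, rfl⟩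
  exact ⟨a, Cbar, C, _, _, h.lpFeas (by linarith), rfl⟩

end
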